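/- For every nonempty finite set D of positive integers with maximum element Δ, there exists a simple graph G of order Δ + 1 whose degree set equals D, and no graph with degree set D has order less than Δ + 1. -/

import Mathlib

/-- The degree set of a finite simple graph: the set of distinct vertex degrees. -/
def degreeSet {V : Type} [Fintype V] (G : SimpleGraph V) [DecidableRel G.Adj] : Finset ℕ :=
  Finset.univ.image (fun v => G.degree v)

open Classical in
/-- Degree of `i` in the graph on `0..n` given by `R`. -/
noncomputable def cntDeg (n : ℕ) (R : ℕ → ℕ → Prop) (i : ℕ) : ℕ :=
  ((Finset.range (n + 1)).filter (fun j => i ≠ j ∧ R i j)).card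

open Classical in
theorem aux_rel (n : ℕ) : ∀ D : Finset ℕ, 0 ∉ D → n ∈ D → (∀ x ∈ D, x ≤ n) →
    ∃ R : ℕ → ℕ → Prop, (∀ i j, R i j → R j i) ∧
      ∀ x, x ∈ D ↔ ∃ i < n + 1,
        cntDeg n R i = x := by
  induction n using Nat.strong_induction_on with
  | _ n ih =>
  intro D h0 hn hle
  have key : ∀ (S : ℕ → ℕ → Prop) (i : ℕ), i < n + 1 →
      cntDeg n (fun i j => ¬ S i j) i +
      cntDeg n S i = n := by
    intro S i hi
    have h1 := Finset.card_filter_add_card_filter_not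
      (s := (Finset.range (n + 1)).erase i) (fun j => S i j)
    rw [Finset.card_erase_of_mem (by simpa using hi), Finset.card_range] at h1
    have e1 : cntDeg n (fun i j => ¬ S i j) i =
      (((Finset.range (n + 1)).erase i).filter (fun j => ¬ S i j)).card := by
      unfold cntDeg; congr 1
      ext j; simp only [Finset.mem_filter, Finset.mem_erase]; tauto
    have e2 : cntDeg n S i =
      (((Finset.range (n + 1)).erase i).filter (fun j => S i j)).card := by
      unfold cntDeg; congr 1
      ext j; simp only [Finset.mem_filter, Finset.mem_erase]; tauto
    rw [e1, e2]; omega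
  by_cases hE : (D.erase n).Nonempty
  · let D' := (D.erase n).image (fun x => n - x)
    have hD' : D'.Nonempty := hE.image _
    have mem' : ∀ y, y ∈ D' ↔ ∃ x ∈ D, x ≠ n ∧ n - x = y := by
      intro y; simp only [D', Finset.mem_image, Finset.mem_erase]
      constructor
      · rintro ⟨x, ⟨a, b⟩, c⟩; exact ⟨x, b, a, c⟩
      · rintro ⟨x, b, a, c⟩; exact ⟨x, ⟨a, b⟩, c⟩
    obtain ⟨m, hm, hmax⟩ : ∃ m ∈ D', ∀ x ∈ D', x ≤ m :=
      ⟨D'.max' hD', D'.max'_mem hD', fun x hx => D'.le_max' x hx⟩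
    have hmn : m < n := by
      obtain ⟨x, hx, hxn, rfl⟩ := (mem' m).1 hm
      have := hle x hx
      have : x ≠ 0 := fun h => h0 (h ▸ hx)
      omega
    obtain ⟨R, hsym, hR⟩ := ih m hmn D' (by
      intro h
      obtain ⟨x, hx, hxn, h⟩ := (mem' 0).1 h
      have := hle x hx
      omega) hm hmax
    let S : ℕ → ℕ → Prop := fun i j => i < m + 1 ∧ j < m + 1 ∧ R i j
    have c1 : ∀ i < m + 1, cntDeg n S i = cntDeg m R i := by
      intro i hi
      unfold cntDeg
      congr 1
      ext j; simp only [S, Finset.mem_filter, Finset.mem_range]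
      constructor
      · rintro ⟨_, a, _, b, c⟩; exact ⟨b, a, c⟩
      · rintro ⟨b, a, c⟩; exact ⟨by omega, a, hi, b, c⟩
    have c2 : ∀ i, ¬ i < m + 1 →
        cntDeg n S i = 0 := by
      intro i hi
      unfold cntDeg
      rw [Finset.card_eq_zero, Finset.eq_empty_iff_forall_notMem]
      intro j hj
      simp only [Finset.mem_filter] at hj
      exact hi hj.2.2.1
    refine ⟨fun i j => ¬ S i j, fun i j h h' => h ⟨h'.2.1, h'.1, hsym _ _ h'.2.2⟩, fun x => ?_⟩
    constructor
    · intro hx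
      by_cases hxn : x = n
      · refine ⟨n, by omega, ?_⟩
        have := key S n (by omega)
        have := c2 n (by omega)
        omega
      · obtain ⟨i, hi, hc⟩ := (hR (n - x)).1 ((mem' _).2 ⟨x, hx, hxn, rfl⟩)
        refine ⟨i, by omega, ?_⟩
        have h1 := key S i (by omega)
        have := hle x hx
        rw [c1 i hi, hc] at h1
        omega
    · rintro ⟨i, hi, hc⟩
      have h1 := key S i hi
      by_cases him : i < m + 1
      · obtain ⟨y, hy, hyn, h⟩ := (mem' _).1 ((hR _).2 ⟨i, him, rfl⟩)
        rw [c1 i him, hc] at h1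
        have := hle y hy
        have : x = y := by omega
        exact this ▸ hy
      · have := c2 i him
        have : x = n := by omega
        exact this ▸ hn
  · have hDn : ∀ x, x ∈ D ↔ x = n := by
      intro x
      constructor
      · intro hx
        by_contra h
        exact hE ⟨x, Finset.mem_erase.2 ⟨h, hx⟩⟩
      · rintro rfl; exact hn
    refine ⟨fun _ _ => ¬ False, fun _ _ h => h, fun x => ?_⟩
    rw [hDn]
    have k : ∀ i < n + 1,
        cntDeg n (fun _ _ => ¬ False) i = n := by
      intro i hi
      have := key (fun _ _ => False) i hi
      have z : cntDeg n (fun _ _ => False) i = 0 := by simp [cntDeg]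
      omega
    constructor
    · rintro rfl; exact ⟨0, by omega, k 0 (by omega)⟩
    · rintro ⟨i, hi, hc⟩
      rw [← hc]; exact k i hi

/-- Kapoor–Polimeni–Wall: for every nonempty finite set `D` of positive integers
with maximum `Δ`, there is a simple graph of order `Δ + 1` with degree set `D`,
and no graph with degree set `D` has smaller order. -/
theorem least_order_degree_set (D : Finset ℕ) (hD : D.Nonempty)
    (hpos : ∀ x ∈ D, 0 < x) :
    (∃ (G : SimpleGraph (Fin (D.max' hD + 1))) (inst : DecidableRel G.Adj),
      @degreeSet _ _ G inst = D) ∧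
    (∀ (p : ℕ) (G : SimpleGraph (Fin p)) [DecidableRel G.Adj],
      degreeSet G = D → D.max' hD + 1 ≤ p) := by
  classical
  constructor
  · obtain ⟨R, hs, hR⟩ := aux_rel (D.max' hD) D (fun h => lt_irrefl _ (hpos 0 h))
      (D.max'_mem hD) (fun x hx => D.le_max' x hx)
    generalize D.max' hD = n at *
    let G : SimpleGraph (Fin (n + 1)) :=
      { Adj := fun i j => (i : ℕ) ≠ j ∧ R i j
        symm := ⟨fun i j h => ⟨h.1.symm, hs _ _ h.2⟩⟩
        loopless := ⟨fun i h => h.1 rfl⟩ }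
    letI inst : DecidableRel G.Adj := Classical.decRel _
    refine ⟨G, inst, ?_⟩
    have hdeg : ∀ v : Fin (n + 1), G.degree v =
        cntDeg n R v := by
      intro v
      rw [← SimpleGraph.card_neighborFinset_eq_degree]
      unfold cntDeg
      refine Finset.card_bij (fun j _ => (j : ℕ)) ?_ ?_ ?_
      · intro j hj
        rw [SimpleGraph.mem_neighborFinset] at hj
        exact Finset.mem_filter.2 ⟨Finset.mem_range.2 j.2, hj⟩
      · intro a _ b _ h; exact Fin.ext h
      · intro b hb
        obtain ⟨h1, h2⟩ := Finset.mem_filter.1 hb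
        refine ⟨⟨b, Finset.mem_range.1 h1⟩, ?_, rfl⟩
        rw [SimpleGraph.mem_neighborFinset]
        exact h2
    ext x
    rw [hR x]
    simp only [degreeSet, Finset.mem_image, Finset.mem_univ, true_and]
    constructor
    · rintro ⟨v, hv⟩
      exact ⟨v, v.2, (hdeg v).symm.trans hv⟩
    · rintro ⟨i, hi, hc⟩
      exact ⟨⟨i, hi⟩, (hdeg ⟨i, hi⟩).trans hc⟩
  · intro p G _ h
    have hm := D.max'_mem hD
    generalize D.max' hD = n at *
    rw [← h] at hm
    simp only [degreeSet, Finset.mem_image, Finset.mem_univ, true_and] at hm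
    obtain ⟨v, hv⟩ := hm
    have := G.degree_lt_card_verts v
    rw [Fintype.card_fin] at this
    omega
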